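/- arXiv:2310.07636 — 3 statements merged into one kernel-verified Lean document; each statement's English description precedes it below -/
import Mathlib

section
/- Let a/b be a rational number in lowest terms with b ≥ 1, and let m be a positive multiple of b. Then there exists ε₀ > 0 (depending on m, a and b) such that for every ε with 0 ≤ ε ≤ ε₀, writing θ = a/b + ε: the maximal path Λ⁺_θ(m) is the straight line segment from (0,0) to (m, ma/b). Consequently the integer lattice points on Λ⁺_θ(m) are exactly the points (kb, ka) for k = 0, …, m/b, so the positive partition p⁺_θ(m) consists of m/b parts all equal to b; in particular, if m > b then p⁺_θ(m) has at least two parts. -/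
open Set

/-- The inclusion of an integer lattice point into the real plane. -/
def latticeToR (p : ℤ × ℤ) : ℝ × ℝ := ((p.1 : ℝ), (p.2 : ℝ))

/-- A polygonal path with vertices at integer lattice points, starting at `(0,0)`,
ending at `(m, e)`, with strictly increasing x-coordinates of the vertices, so that
the path is the graph of a piecewise linear function on `[0, m]`. -/
structure LatticePath (m : ℕ) (e : ℤ) where
  n : ℕ
  v : Fin (n + 1) → ℤ × ℤ
  first : v 0 = (0, 0)
  last : v (Fin.last n) = ((m : ℤ), e)
  mono : ∀ i : Fin n, (v i.castSucc).1 < (v i.succ).1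

namespace LatticePath

variable {m : ℕ} {e : ℤ}

/-- The trace of the path in the plane: the union of the closed segments joining
consecutive vertices. -/
def graph (P : LatticePath m e) : Set (ℝ × ℝ) :=
  ⋃ i : Fin P.n, segment ℝ (latticeToR (P.v i.castSucc)) (latticeToR (P.v i.succ))

/-- The slopes of consecutive edges are nonincreasing: the path is the graph of a
piecewise linear concave function. -/
def IsConcave (P : LatticePath m e) : Prop :=
  ∀ i : ℕ, ∀ h : i + 2 ≤ P.n,
    ((P.v ⟨i + 2, by omega⟩).2 - (P.v ⟨i + 1, by omega⟩).2) *
        ((P.v ⟨i + 1, by omega⟩).1 - (P.v ⟨i, by omega⟩).1) ≤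
      ((P.v ⟨i + 1, by omega⟩).2 - (P.v ⟨i, by omega⟩).2) *
        ((P.v ⟨i + 2, by omega⟩).1 - (P.v ⟨i + 1, by omega⟩).1)

/-- The slopes of consecutive edges are nondecreasing: the path is the graph of a
piecewise linear convex function. -/
def IsConvex (P : LatticePath m e) : Prop :=
  ∀ i : ℕ, ∀ h : i + 2 ≤ P.n,
    ((P.v ⟨i + 1, by omega⟩).2 - (P.v ⟨i, by omega⟩).2) *
        ((P.v ⟨i + 2, by omega⟩).1 - (P.v ⟨i + 1, by omega⟩).1) ≤
      ((P.v ⟨i + 2, by omega⟩).2 - (P.v ⟨i + 1, by omega⟩).2) *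
        ((P.v ⟨i + 1, by omega⟩).1 - (P.v ⟨i, by omega⟩).1)

end LatticePath

/-- `S` lies pointwise (in the vertical direction) below `T`. -/
def GraphLE (S T : Set (ℝ × ℝ)) : Prop :=
  ∀ x y y' : ℝ, (x, y) ∈ S → (x, y') ∈ T → y ≤ y'

/-- An admissible path for the positive partition `p⁺_θ(m)`: a lattice path from
`(0,0)` to `(m, ⌊mθ⌋)` which is the graph of a piecewise linear concave function
and does not go above the line `y = θx`. -/
def PosPath (θ : ℝ) (m : ℕ) (P : LatticePath m ⌊(m : ℝ) * θ⌋) : Prop :=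
  P.IsConcave ∧ ∀ p ∈ P.graph, p.2 ≤ θ * p.1

/-- An admissible path for the negative partition `p⁻_θ(m)`: a lattice path from
`(0,0)` to `(m, ⌈mθ⌉)` which is the graph of a piecewise linear convex function
and does not go below the line `y = θx`. -/
def NegPath (θ : ℝ) (m : ℕ) (P : LatticePath m ⌈(m : ℝ) * θ⌉) : Prop :=
  P.IsConvex ∧ ∀ p ∈ P.graph, θ * p.1 ≤ p.2

/-- `P` is the pointwise maximal admissible path `Λ⁺_θ(m)`. -/
def IsMaxPosPath (θ : ℝ) (m : ℕ) (P : LatticePath m ⌊(m : ℝ) * θ⌋) : Prop :=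
  PosPath θ m P ∧
    ∀ Q : LatticePath m ⌊(m : ℝ) * θ⌋, PosPath θ m Q → GraphLE Q.graph P.graph

/-- `P` is the pointwise minimal admissible path `Λ⁻_θ(m)`. -/
def IsMinNegPath (θ : ℝ) (m : ℕ) (P : LatticePath m ⌈(m : ℝ) * θ⌉) : Prop :=
  NegPath θ m P ∧
    ∀ Q : LatticePath m ⌈(m : ℝ) * θ⌉, NegPath θ m Q → GraphLE P.graph Q.graph

/-- The x-coordinates of the integer lattice points lying on `S`. -/
def latticeXs (S : Set (ℝ × ℝ)) : Set ℤ :=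
  {x : ℤ | ∃ y : ℤ, ((x : ℝ), (y : ℝ)) ∈ S}

open Classical in
/-- The multiset of consecutive gaps of a finite set of integers. -/
noncomputable def setGaps (X : Set ℤ) : Multiset ℤ :=
  if h : X.Finite then
    Multiset.ofList
      (List.zipWith (fun a b => b - a) (h.toFinset.sort (· ≤ ·))
        (h.toFinset.sort (· ≤ ·)).tail)
  else 0

/-- The multiset of horizontal displacements between consecutive integer lattice
points lying on the path `P`: the partition `p⁺_θ(m)` (resp. `p⁻_θ(m)`) is
`pathPartition` of the maximal (resp. minimal) admissible path. -/
noncomputable def pathPartition {m : ℕ} {e : ℤ} (P : LatticePath m e) : Multiset ℤ :=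
  setGaps (latticeXs P.graph)

namespace LatticePath

variable {m : ℕ} {e : ℤ}

theorem strictMono_fst (P : LatticePath m e) : StrictMono fun i => (P.v i).1 :=
  Fin.strictMono_iff_lt_succ.2 P.mono

theorem fst_nonneg (P : LatticePath m e) (i : Fin (P.n + 1)) : 0 ≤ (P.v i).1 := by
  simpa [P.first] using P.strictMono_fst.monotone (Fin.zero_le i)

theorem fst_le (P : LatticePath m e) (i : Fin (P.n + 1)) : (P.v i).1 ≤ m := by
  simpa [P.last] using P.strictMono_fst.monotone (Fin.le_last i)

/-- The graph is contained in every convex set containing the vertices. -/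
theorem graph_subset (P : LatticePath m e) {C : Set (ℝ × ℝ)} (hC : Convex ℝ C)
    (h : ∀ i, latticeToR (P.v i) ∈ C) : P.graph ⊆ C :=
  iUnion_subset fun _ => hC.segment_subset (h _) (h _)

theorem n_pos (P : LatticePath m e) (hm : 0 < m) : 0 < P.n := by
  rcases P with ⟨n, v, first, last, mono⟩
  rcases Nat.eq_zero_or_pos n with rfl | h
  · have h0 : ((0 : ℤ), (0 : ℤ)) = ((m : ℤ), e) := first.symm.trans last
    have := congrArg Prod.fst h0
    simp at this
    omega
  · exact h

theorem vertex_mem_graph (P : LatticePath m e) (hm : 0 < m) (i : Fin (P.n + 1)) :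
    latticeToR (P.v i) ∈ P.graph := by
  rw [graph, mem_iUnion]
  induction i using Fin.cases with
  | zero => exact ⟨⟨0, P.n_pos hm⟩, left_mem_segment ℝ _ _⟩
  | succ j => exact ⟨j, right_mem_segment ℝ _ _⟩

/-- The graph of a path projects onto the whole interval `[0, m]`. -/
theorem exists_mem_graph (P : LatticePath m e) (hm : 0 < m) {x : ℝ} (h0 : 0 ≤ x) (hx : x ≤ m) :
    ∃ y, (x, y) ∈ P.graph := by
  have key : ∀ i : Fin (P.n + 1), x ≤ (P.v i).1 → ∃ y, (x, y) ∈ P.graph := by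
    intro i
    induction i using Fin.induction with
    | zero =>
      intro h
      have hx0 : x = 0 := le_antisymm (by simpa [P.first] using h) h0
      exact ⟨0, by simpa [latticeToR, P.first, hx0] using P.vertex_mem_graph hm 0⟩
    | succ j ih =>
      intro h
      rcases le_total x (P.v j.castSucc).1 with hj | hj
      · exact ih hj
      · have hmem : x ∈ segment ℝ ((P.v j.castSucc).1 : ℝ) ((P.v j.succ).1 : ℝ) := by
          rw [segment_eq_Icc (hj.trans h)]
          exact ⟨hj, h⟩
        obtain ⟨s, t, hs, ht, hst, hxe⟩ := hmem
        refine ⟨s * (P.v j.castSucc).2 + t * (P.v j.succ).2,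
          mem_iUnion.2 ⟨j, s, t, hs, ht, hst, ?_⟩⟩
        simpa [latticeToR] using hxe
  exact key (Fin.last _) (by simpa [P.last] using hx)

/-- The path with a single edge. -/
def single (hm : 0 < m) (e : ℤ) : LatticePath m e where
  n := 1
  v := ![(0, 0), (m, e)]
  first := rfl
  last := rfl
  mono i := by
    fin_cases i
    simpa using hm

theorem graph_single (hm : 0 < m) (e : ℤ) :
    (single hm e).graph = segment ℝ ((0 : ℝ), (0 : ℝ)) ((m : ℝ), (e : ℝ)) := by
  have : (single hm e).graph =
      ⋃ _ : Fin 1, segment ℝ (latticeToR (0, 0)) (latticeToR ((m : ℤ), e)) :=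
    iUnion_congr fun i => by
      fin_cases i
      rfl
  rw [this, iUnion_const]
  simp [latticeToR]

theorem isConcave_single (hm : 0 < m) (e : ℤ) : (single hm e).IsConcave := by
  intro i h
  have : i + 2 ≤ 1 := h
  omega

end LatticePath

/-- A point of the segment from the origin to `(m, e)` is determined by its abscissa. -/
theorem mem_segment_origin_iff {m e : ℝ} (hm : 0 < m) {p : ℝ × ℝ} :
    p ∈ segment ℝ ((0 : ℝ), (0 : ℝ)) (m, e) ↔ 0 ≤ p.1 ∧ p.1 ≤ m ∧ p.2 * m = e * p.1 := by
  constructor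
  · rintro ⟨s, t, hs, ht, hst, rfl⟩
    simp only [Prod.smul_mk, smul_eq_mul, mul_zero, Prod.mk_add_mk, zero_add]
    exact ⟨by positivity, by nlinarith, by ring⟩
  · rintro ⟨h0, h1, h2⟩
    refine ⟨1 - p.1 / m, p.1 / m, sub_nonneg.2 ((div_le_one hm).2 h1), by positivity, by ring, ?_⟩
    ext
    · simp [hm.ne']
    · simp
      field_simp
      linarith

/-- The gaps of a finite set listed in increasing order. -/
theorem setGaps_toFinset {l : List ℤ} (hl : l.Pairwise (· < ·)) :
    setGaps {x | x ∈ l} = Multiset.ofList (List.zipWith (fun a b => b - a) l l.tail) := by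
  have hfin : {x | x ∈ l}.Finite := l.finite_toSet
  have hs : hfin.toFinset = l.toFinset := by
    ext
    simp
  have hsort : l.toFinset.sort (· ≤ ·) = l :=
    (List.toFinset_sort (· ≤ ·) (hl.imp ne_of_lt)).2 (hl.imp le_of_lt)
  rw [setGaps, dif_pos hfin, hs, hsort]

/-- The multiples `0, b, …, q b` have `q` gaps, all equal to `b`. -/
theorem setGaps_multiples {b : ℤ} (hb : 0 < b) (q : ℕ) :
    setGaps {x | ∃ k : ℤ, 0 ≤ k ∧ k ≤ q ∧ x = k * b} = Multiset.replicate q b := by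
  set l : List ℤ := (List.range (q + 1)).map fun k : ℕ => (k : ℤ) * b with hl
  have hset : {x | ∃ k : ℤ, 0 ≤ k ∧ k ≤ q ∧ x = k * b} = {x | x ∈ l} := by
    ext x
    simp only [mem_ofPred_eq, hl, List.mem_map, List.mem_range]
    constructor
    · rintro ⟨k, h0, hk, rfl⟩
      lift k to ℕ using h0
      exact ⟨k, by omega, rfl⟩
    · rintro ⟨k, hk, rfl⟩
      exact ⟨k, by omega, by omega, rfl⟩
  have hpw : l.Pairwise (· < ·) :=
    List.pairwise_map.2 <| List.pairwise_lt_range.imp fun h => by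
      have := Int.ofNat_lt.2 h
      nlinarith
  rw [hset, setGaps_toFinset hpw, ← Multiset.coe_replicate]
  congr 1
  apply List.ext_getElem
  · simp [hl]
  · intro i h₁ h₂
    simp [hl]
    ring

/-- For `θ` slightly larger than `a / b`, a lattice point with abscissa in `[0, m]` below the line
of slope `θ` is below the line of slope `a / b`. -/
theorem mul_le_mul_of_le_perturbed {a x y : ℤ} {b m : ℕ} (hb : 0 < b) (hm : 0 < m) {ε : ℝ}
    (hε : ε ≤ 1 / (2 * m * b)) (hx : 0 ≤ x) (hxm : x ≤ m)
    (h : (y : ℝ) ≤ ((a : ℝ) / b + ε) * x) : y * b ≤ a * x := by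
  have hbR : (0 : ℝ) < b := by exact_mod_cast hb
  have hmR : (0 : ℝ) < m := by exact_mod_cast hm
  have hxR : (x : ℝ) ≤ m := by exact_mod_cast hxm
  have h1 : (y : ℝ) * b ≤ a * x + ε * b * x := by
    calc (y : ℝ) * b ≤ ((a : ℝ) / b + ε) * x * b := by gcongr
      _ = a * x + ε * b * x := by field_simp
  have h2 : ε * b * x ≤ 1 / 2 := by
    calc ε * b * x ≤ 1 / (2 * m * b) * b * m := by gcongr
      _ = 1 / 2 := by field_simp
  have h3 : ((y * b : ℤ) : ℝ) < ((a * x + 1 : ℤ) : ℝ) := by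
    push_cast
    linarith
  have := Int.cast_lt.1 h3
  omega

/-- For `θ` slightly larger than `a / b`, the maximal path of length `b q` is a segment. -/
theorem IsMaxPosPath.graph_eq_segment {a : ℤ} {b q : ℕ} (hb : 0 < b) (hq : 0 < b * q) {ε : ℝ}
    (hε : 0 ≤ ε) (hε' : ε ≤ 1 / (2 * (b * q : ℕ) * b))
    {P : LatticePath (b * q) ⌊((b * q : ℕ) : ℝ) * ((a : ℝ) / (b : ℝ) + ε)⌋}
    (hP : IsMaxPosPath ((a : ℝ) / b + ε) (b * q) P) :
    P.graph = segment ℝ ((0 : ℝ), (0 : ℝ)) (((b * q : ℕ) : ℝ), (a : ℝ) * q) := by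
  have hbR : (0 : ℝ) < b := by exact_mod_cast hb
  have hmR : (0 : ℝ) < (b * q : ℕ) := by exact_mod_cast hq
  have hqR : (0 : ℝ) < q := by exact_mod_cast Nat.pos_of_mul_pos_left hq
  have hfloor : ⌊((b * q : ℕ) : ℝ) * ((a : ℝ) / (b : ℝ) + ε)⌋ = a * q := by
    apply le_antisymm
    · have h := mul_le_mul_of_le_perturbed (a := a) (x := (b * q : ℕ)) hb hq hε'
        (by positivity) le_rfl ((Int.floor_le _).trans_eq (mul_comm _ _))
      have hab : a * (b * q : ℕ) = a * q * b := by
        push_cast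
        ring
      rw [hab] at h
      exact le_of_mul_le_mul_right h (by exact_mod_cast hb)
    · rw [Int.le_floor]
      push_cast
      calc (a : ℝ) * q = b * q * (a / b) := by field_simp
        _ ≤ b * q * (a / b + ε) := by
          gcongr
          linarith
  obtain ⟨⟨-, hbelow⟩, hmax⟩ := hP
  have hupper : P.graph ⊆ {p : ℝ × ℝ | (0 ≤ p.1 ∧ p.1 ≤ (b * q : ℕ)) ∧ p.2 * b ≤ a * p.1} := by
    apply P.graph_subset
    · rintro p ⟨⟨hp0, hp1⟩, hp2⟩ r ⟨⟨hr0, hr1⟩, hr2⟩ s t hs ht hst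
      simp only [mem_ofPred_eq, Prod.fst_add, Prod.smul_fst, Prod.snd_add, Prod.smul_snd,
        smul_eq_mul]
      refine ⟨⟨by positivity, ?_⟩, ?_⟩
      · calc s * p.1 + t * r.1 ≤ s * (b * q : ℕ) + t * (b * q : ℕ) := by gcongr
          _ = (b * q : ℕ) := by rw [← add_mul, hst, one_mul]
      · linarith [mul_le_mul_of_nonneg_left hp2 hs, mul_le_mul_of_nonneg_left hr2 ht]
    · intro i
      have h := mul_le_mul_of_le_perturbed hb hq hε' (P.fst_nonneg i) (P.fst_le i)
        (hbelow _ (P.vertex_mem_graph hq i))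
      simp only [latticeToR, mem_ofPred_eq]
      exact_mod_cast And.intro (And.intro (P.fst_nonneg i) (P.fst_le i)) h
  have hgraph := LatticePath.graph_single hq ⌊((b * q : ℕ) : ℝ) * ((a : ℝ) / (b : ℝ) + ε)⌋
  have hcast : ((⌊((b * q : ℕ) : ℝ) * ((a : ℝ) / (b : ℝ) + ε)⌋ : ℤ) : ℝ) = a * q := by
    rw [hfloor]
    push_cast
    rfl
  rw [hcast] at hgraph
  have hline : ∀ {x y : ℝ}, y * (b * q : ℕ) = a * q * x ↔ y = a / b * x := by
    intro x y
    push_cast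
    rw [div_mul_eq_mul_div, eq_div_iff hbR.ne']
    constructor
    · intro h
      exact mul_right_cancel₀ hqR.ne' (by linarith)
    · intro h
      linear_combination (q : ℝ) * h
  have hlower := hmax (LatticePath.single hq _) ⟨LatticePath.isConcave_single hq _, by
    rintro ⟨x, y⟩ hp
    rw [hgraph, mem_segment_origin_iff hmR] at hp
    obtain ⟨h0, -, h2⟩ := hp
    simp only at h0 h2 ⊢
    rw [hline] at h2
    nlinarith⟩
  have hsub : P.graph ⊆ segment ℝ ((0 : ℝ), (0 : ℝ)) (((b * q : ℕ) : ℝ), (a : ℝ) * q) := by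
    rintro ⟨x, y⟩ hp
    obtain ⟨⟨h0, h1⟩, h2⟩ := hupper hp
    rw [mem_segment_origin_iff hmR]
    refine ⟨h0, h1, hline.2 (le_antisymm ?_ ?_)⟩
    · rwa [div_mul_eq_mul_div, le_div_iff₀ hbR]
    · refine hlower x _ y ?_ hp
      rw [hgraph, mem_segment_origin_iff hmR]
      exact ⟨h0, h1, hline.2 rfl⟩
  refine hsub.antisymm ?_
  rintro ⟨x, y⟩ hp
  obtain ⟨h0, h1, h2⟩ := (mem_segment_origin_iff hmR).1 hp
  obtain ⟨y', hy'⟩ := P.exists_mem_graph hq h0 h1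
  obtain ⟨-, -, h2'⟩ := (mem_segment_origin_iff hmR).1 (hsub hy')
  have hy : y = y' := (hline.1 h2).trans (hline.1 h2').symm
  rwa [hy]

/-- The lattice points on a segment of slope `a / b` in lowest terms. -/
theorem latticeToR_mem_segment_iff {a : ℤ} {b q : ℕ} (hq : 0 < b * q)
    (hab : Int.gcd a (b : ℤ) = 1) {p : ℤ × ℤ} :
    latticeToR p ∈ segment ℝ ((0 : ℝ), (0 : ℝ)) (((b * q : ℕ) : ℝ), (a : ℝ) * q) ↔
      ∃ k : ℤ, 0 ≤ k ∧ k ≤ q ∧ p = (k * (b : ℤ), k * a) := by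
  have hb : (0 : ℤ) < b := by exact_mod_cast Nat.pos_of_mul_pos_right hq
  have hq' : (0 : ℤ) < q := by exact_mod_cast Nat.pos_of_mul_pos_left hq
  obtain ⟨x, y⟩ := p
  rw [mem_segment_origin_iff (by exact_mod_cast hq)]
  simp only [latticeToR, Prod.mk.injEq]
  norm_cast
  push_cast
  constructor
  · rintro ⟨h0, h1, h2⟩
    have h3 : y * b = a * x := mul_right_cancel₀ hq'.ne' (by linarith)
    obtain ⟨k, rfl⟩ : (b : ℤ) ∣ x :=
      (Int.isCoprime_iff_gcd_eq_one.2 hab).symm.dvd_of_dvd_mul_left ⟨y, by linarith⟩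
    exact ⟨k, by nlinarith, by nlinarith, by ring, mul_right_cancel₀ hb.ne' (by linarith)⟩
  · rintro ⟨k, h0, h1, rfl, rfl⟩
    exact ⟨by positivity, by nlinarith, by ring⟩

/-- Let `a/b` be a rational number in lowest terms with `b ≥ 1`
and let `m` be a positive multiple of `b`.  Then for all sufficiently small
`ε ≥ 0`, with `θ = a/b + ε`, the maximal path `Λ⁺_θ(m)` is the straight segment
from `(0,0)` to `(m, ma/b)`, its lattice points are exactly the points
`(kb, ka)` for `k = 0, …, m/b`, the positive partition `p⁺_θ(m)` consists of
`m/b` copies of `b`, and if `m > b` it has at least two parts. -/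
theorem statement2 (a : ℤ) (b : ℕ) (hb : 0 < b) (hab : Int.gcd a (b : ℤ) = 1)
    (m : ℕ) (hm : 0 < m) (hbm : b ∣ m) :
    ∃ ε₀ : ℝ, 0 < ε₀ ∧ ∀ ε : ℝ, 0 ≤ ε → ε ≤ ε₀ →
      ∀ P : LatticePath m ⌊(m : ℝ) * ((a : ℝ) / (b : ℝ) + ε)⌋,
        IsMaxPosPath ((a : ℝ) / (b : ℝ) + ε) m P →
          P.graph = segment ℝ ((0 : ℝ), (0 : ℝ))
              ((m : ℝ), (m : ℝ) * (a : ℝ) / (b : ℝ)) ∧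
          {p : ℤ × ℤ | latticeToR p ∈ P.graph} =
            {p : ℤ × ℤ | ∃ k : ℤ, 0 ≤ k ∧ k ≤ ((m / b : ℕ) : ℤ) ∧
              p = (k * (b : ℤ), k * a)} ∧
          pathPartition P = Multiset.replicate (m / b) ((b : ℕ) : ℤ) ∧
          (b < m → 2 ≤ Multiset.card (pathPartition P)) := by
  obtain ⟨q, rfl⟩ := hbm
  have hbR : (0 : ℝ) < b := by exact_mod_cast hb
  have hmR : (0 : ℝ) < (b * q : ℕ) := by exact_mod_cast hm
  refine ⟨1 / (2 * (b * q : ℕ) * b), by positivity, fun ε hε hε' P hP => ?_⟩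
  have hseg := hP.graph_eq_segment hb hm hε hε'
  have hlat : ∀ p, latticeToR p ∈ P.graph ↔
      ∃ k : ℤ, 0 ≤ k ∧ k ≤ q ∧ p = (k * (b : ℤ), k * a) := fun p => by
    rw [hseg, latticeToR_mem_segment_iff hm hab]
  have hpart : pathPartition P = Multiset.replicate q (b : ℤ) := by
    rw [pathPartition, ← setGaps_multiples (by exact_mod_cast hb)]
    congr 1
    ext x
    constructor
    · rintro ⟨y, hy⟩
      obtain ⟨k, h0, hk, hp⟩ := (hlat (x, y)).1 hy
      exact ⟨k, h0, hk, congrArg Prod.fst hp⟩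
    · rintro ⟨k, h0, hk, rfl⟩
      exact ⟨k * a, (hlat (k * b, k * a)).2 ⟨k, h0, hk, rfl⟩⟩
  rw [Nat.mul_div_cancel_left q hb]
  refine ⟨?_, ext hlat, hpart, fun hlt => ?_⟩
  · rw [hseg]
    congr 2
    push_cast
    field_simp
  · rw [hpart, Multiset.card_replicate]
    by_contra! h
    nlinarith
end

section
/- Let θ be a real number and let m ≥ 3 be an integer. If m·min({θ}, 1 − {θ}) < 1, then the total number of parts of p⁺_θ(m) and p⁻_θ(m), counted with multiplicity, is at least 4; in other words, the pair (θ, m) is not exceptional. -/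
open Set

namespace LatticePath

variable {m : ℕ} {e : ℤ}

theorem fst_mem_Icc_of_mem_graph (P : LatticePath m e) {p : ℝ × ℝ} (hp : p ∈ P.graph) :
    p.1 ∈ Icc (0 : ℝ) m := by
  obtain ⟨i, hi⟩ := mem_iUnion.1 hp
  have hconv : Convex ℝ {q : ℝ × ℝ | q.1 ∈ Icc (0 : ℝ) m} :=
    (convex_Icc (0 : ℝ) m).linear_preimage (LinearMap.fst ℝ ℝ ℝ)
  have hv : ∀ j, latticeToR (P.v j) ∈ {q : ℝ × ℝ | q.1 ∈ Icc (0 : ℝ) m} := fun j =>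
    ⟨by simpa [latticeToR] using P.fst_nonneg j,
      by simpa [latticeToR] using (by exact_mod_cast P.fst_le j : ((P.v j).1 : ℝ) ≤ (m : ℝ))⟩
  exact hconv.segment_subset (hv _) (hv _) hi

theorem finite_latticeXs_graph (P : LatticePath m e) : (latticeXs P.graph).Finite := by
  refine (finite_Icc (0 : ℤ) m).subset ?_
  rintro x ⟨y, hy⟩
  have := P.fst_mem_Icc_of_mem_graph hy
  simp only [mem_Icc] at this
  exact ⟨by exact_mod_cast this.1, by exact_mod_cast this.2⟩

theorem card_le_card_pathPartition_add_one (P : LatticePath m e) (S : Finset ℤ)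
    (hS : ↑S ⊆ latticeXs P.graph) : S.card ≤ Multiset.card (pathPartition P) + 1 := by
  have hle : S.card ≤ P.finite_latticeXs_graph.toFinset.card :=
    Finset.card_le_card fun x hx => P.finite_latticeXs_graph.mem_toFinset.2 (hS hx)
  simp only [pathPartition, setGaps, dif_pos P.finite_latticeXs_graph, Multiset.coe_card,
    List.length_zipWith, List.length_tail, Finset.length_sort]
  omega

theorem one_le_card_pathPartition (P : LatticePath m e) (hm : 0 < m) :
    1 ≤ Multiset.card (pathPartition P) := by
  have hcard : ({0, (m : ℤ)} : Finset ℤ).card = 2 := Finset.card_pair (by omega)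
  have := P.card_le_card_pathPartition_add_one {0, (m : ℤ)} (by
    intro x hx
    simp only [Finset.coe_insert, Finset.coe_singleton, mem_insert_iff, mem_singleton_iff] at hx
    rcases hx with rfl | rfl
    · exact ⟨0, by simpa [P.first, latticeToR] using P.vertex_mem_graph hm 0⟩
    · exact ⟨e, by simpa [P.last, latticeToR] using P.vertex_mem_graph hm (Fin.last _)⟩)
  omega

theorem mem_graph_of_vertices_on_line (P : LatticePath m e) (hm : 0 < m) (k : ℤ)
    (hP : ∀ i, (P.v i).2 = k * (P.v i).1) (x : ℝ) (hx : x ∈ Icc (0 : ℝ) m) :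
    (x, k * x) ∈ P.graph := by
  have key : ∀ j : Fin (P.n + 1), x ≤ (P.v j).1 → (x, k * x) ∈ P.graph := by
    intro j
    induction j using Fin.induction with
    | zero =>
      intro h
      have h0 : x = 0 := le_antisymm (by simpa [P.first] using h) hx.1
      simpa [h0, P.first, latticeToR] using P.vertex_mem_graph hm 0
    | succ i ih =>
      intro h
      rcases le_total x (P.v i.castSucc).1 with h' | h'
      · exact ih h'
      · refine mem_iUnion.2 ⟨i, ?_⟩
        have hlt : ((P.v i.castSucc).1 : ℝ) ≤ (P.v i.succ).1 := h'.trans h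
        have hxs : x ∈ segment ℝ ((P.v i.castSucc).1 : ℝ) (P.v i.succ).1 := by
          rw [segment_eq_Icc hlt]; exact ⟨h', h⟩
        obtain ⟨a, b, ha, hb, hab, rfl⟩ := hxs
        refine ⟨a, b, ha, hb, hab, ?_⟩
        ext
        · simp [latticeToR]
        · simp [latticeToR, hP]; ring
  exact key (Fin.last _) (by simpa [P.last] using hx.2)

theorem le_card_pathPartition_of_vertices_on_line (P : LatticePath m e) (hm : 0 < m) (k : ℤ)
    (hP : ∀ i, (P.v i).2 = k * (P.v i).1) : m ≤ Multiset.card (pathPartition P) := by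
  have := P.card_le_card_pathPartition_add_one (Finset.Icc 0 (m : ℤ)) (by
    intro x hx
    simp only [Finset.coe_Icc, mem_Icc] at hx
    refine ⟨k * x, ?_⟩
    push_cast
    exact P.mem_graph_of_vertices_on_line hm k hP x
      ⟨by exact_mod_cast hx.1, by exact_mod_cast hx.2⟩)
  simp only [Int.card_Icc] at this
  omega

/-- The path consisting of a single edge. -/
def straight (hm : 0 < m) (e : ℤ) : LatticePath m e where
  n := 1
  v := ![(0, 0), ((m : ℤ), e)]
  first := rfl
  last := rfl
  mono i := by
    fin_cases i
    simpa using hm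

theorem straight_isConcave (hm : 0 < m) (e : ℤ) : (straight hm e).IsConcave := by
  intro i h
  have : i + 2 ≤ 1 := h
  omega

theorem straight_isConvex (hm : 0 < m) (e : ℤ) : (straight hm e).IsConvex := by
  intro i h
  have : i + 2 ≤ 1 := h
  omega

theorem straight_vertices_on_line (hm : 0 < m) {k : ℤ} (he : e = k * m)
    (i : Fin ((straight hm e).n + 1)) :
    ((straight hm e).v i).2 = k * ((straight hm e).v i).1 := by
  change Fin 2 at i
  fin_cases i <;> simp [straight, he]

theorem snd_eq_of_mem_graph_straight (hm : 0 < m) {k : ℤ} (he : e = k * m) {p : ℝ × ℝ}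
    (hp : p ∈ (straight hm e).graph) : p.2 = k * p.1 := by
  obtain ⟨i, a, b, -, -, -, rfl⟩ := mem_iUnion.1 hp
  simp [latticeToR, straight_vertices_on_line hm he]
  ring

end LatticePath

open LatticePath

theorem IsMaxPosPath.vertices_on_line {θ : ℝ} {m : ℕ} {P : LatticePath m ⌊(m : ℝ) * θ⌋}
    (hP : IsMaxPosPath θ m P) (hm : 0 < m) (h : (m : ℝ) * Int.fract θ < 1)
    (i : Fin (P.n + 1)) : (P.v i).2 = ⌊θ⌋ * (P.v i).1 := by
  have hf := Int.floor_add_fract θ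
  have hf0 := Int.fract_nonneg θ
  have hm0 : (0 : ℝ) ≤ m := Nat.cast_nonneg m
  have he : ⌊(m : ℝ) * θ⌋ = ⌊θ⌋ * m := by
    rw [Int.floor_eq_iff]
    push_cast
    constructor <;> nlinarith
  have hx0 : (0 : ℝ) ≤ (P.v i).1 := by exact_mod_cast P.fst_nonneg i
  have hxm : ((P.v i).1 : ℝ) ≤ m := by exact_mod_cast P.fst_le i
  have hmem := P.vertex_mem_graph hm i
  apply le_antisymm
  · have hle := hP.1.2 _ hmem
    simp only [latticeToR] at hle
    have : ((P.v i).2 : ℝ) < ⌊θ⌋ * (P.v i).1 + 1 := by nlinarith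
    exact Int.lt_add_one_iff.1 (by exact_mod_cast this)
  · have hadm : PosPath θ m (straight hm _) := by
      refine ⟨straight_isConcave hm _, fun p hp => ?_⟩
      rw [snd_eq_of_mem_graph_straight hm he hp]
      exact mul_le_mul_of_nonneg_right (Int.floor_le θ) (fst_mem_Icc_of_mem_graph _ hp).1
    have := hP.2 _ hadm _ _ _ (mem_graph_of_vertices_on_line _ hm ⌊θ⌋
      (straight_vertices_on_line hm he) _ ⟨hx0, hxm⟩) hmem
    exact_mod_cast this

theorem IsMinNegPath.vertices_on_line {θ : ℝ} {m : ℕ} {Q : LatticePath m ⌈(m : ℝ) * θ⌉}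
    (hQ : IsMinNegPath θ m Q) (hm : 0 < m) (h : (m : ℝ) * (1 - Int.fract θ) < 1)
    (i : Fin (Q.n + 1)) : (Q.v i).2 = (⌊θ⌋ + 1) * (Q.v i).1 := by
  have hf := Int.floor_add_fract θ
  have hf1 := Int.fract_lt_one θ
  have hm0 : (0 : ℝ) ≤ m := Nat.cast_nonneg m
  have he : ⌈(m : ℝ) * θ⌉ = (⌊θ⌋ + 1) * m := by
    rw [Int.ceil_eq_iff]
    push_cast
    constructor <;> nlinarith
  have hx0 : (0 : ℝ) ≤ (Q.v i).1 := by exact_mod_cast Q.fst_nonneg i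
  have hxm : ((Q.v i).1 : ℝ) ≤ m := by exact_mod_cast Q.fst_le i
  have hmem := Q.vertex_mem_graph hm i
  apply le_antisymm
  · have hadm : NegPath θ m (straight hm _) := by
      refine ⟨straight_isConvex hm _, fun p hp => ?_⟩
      rw [snd_eq_of_mem_graph_straight hm he hp]
      push_cast
      exact mul_le_mul_of_nonneg_right (Int.lt_floor_add_one θ).le
        (fst_mem_Icc_of_mem_graph _ hp).1
    have := hQ.2 _ hadm _ _ _ hmem (mem_graph_of_vertices_on_line _ hm (⌊θ⌋ + 1)
      (straight_vertices_on_line hm he) _ ⟨hx0, hxm⟩)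
    exact_mod_cast this
  · have hle := hQ.1.2 _ hmem
    simp only [latticeToR] at hle
    have : (⌊θ⌋ + 1) * ((Q.v i).1 : ℝ) < (Q.v i).2 + 1 := by nlinarith
    exact Int.lt_add_one_iff.1 (by exact_mod_cast this)

/-- Let `θ` be real and `m ≥ 3` an integer.  If
`m · min({θ}, 1 − {θ}) < 1` then `|p⁺_θ(m)| + |p⁻_θ(m)| ≥ 4`, i.e. the pair
`(θ, m)` is not exceptional. -/
theorem statement7 (θ : ℝ) (m : ℕ) (hm : 3 ≤ m)
    (h : (m : ℝ) * min (Int.fract θ) (1 - Int.fract θ) < 1) :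
    ∀ (P : LatticePath m ⌊(m : ℝ) * θ⌋) (Q : LatticePath m ⌈(m : ℝ) * θ⌉),
      IsMaxPosPath θ m P → IsMinNegPath θ m Q →
      4 ≤ Multiset.card (pathPartition P) + Multiset.card (pathPartition Q) := by
  intro P Q hP hQ
  have hm0 : 0 < m := by omega
  have hP1 := P.one_le_card_pathPartition hm0
  have hQ1 := Q.one_le_card_pathPartition hm0
  rcases min_choice (Int.fract θ) (1 - Int.fract θ) with hc | hc <;> rw [hc] at h
  · have := P.le_card_pathPartition_of_vertices_on_line hm0 _ (hP.vertices_on_line hm0 h)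
    omega
  · have := Q.le_card_pathPartition_of_vertices_on_line hm0 _ (hQ.vertices_on_line hm0 h)
    omega
end

section
/- Let M > 1 be a real number. Then there exists ε_M > 0 such that for any two orbit sets m₁, m₂ : P → ℕ with 𝒜(m₁) ≠ 𝒜(m₂), if either (i) m₁ or m₂ has complexity ≤ M, or (ii) there exists γ₀ ∈ P such that for both k = 1 and k = 2 the set {γ ∈ P : m_k(γ) > M} is exactly {γ₀}, then |𝒜(m₁) − 𝒜(m₂)| ≥ ε_M. -/
/-- The linear form `d ↦ Σ_γ d(γ)·w(γ)` takes only finitely many values on integer vectors whose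
weighted coordinates are bounded, so its nonzero values there are bounded away from `0`. -/
theorem exists_pos_le_abs_sum_of_bounded {P : Type*} [Fintype P] (w : P → ℝ)
    (hw : ∀ γ, 0 < w γ) (C : ℝ) :
    ∃ ε : ℝ, 0 < ε ∧ ∀ d : P → ℤ, (∀ γ, |(d γ : ℝ)| * w γ ≤ C) →
      (∑ γ, (d γ : ℝ) * w γ) ≠ 0 → ε ≤ |∑ γ, (d γ : ℝ) * w γ| := by
  have hfin : {d : P → ℤ | ∀ γ, d γ ∈ Set.Icc (-⌈C / w γ⌉) ⌈C / w γ⌉}.Finite :=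
    Set.Finite.pi' fun γ => Set.finite_Icc _ _
  let T : Set ℝ := insert 1 ((fun d : P → ℤ => |∑ γ, (d γ : ℝ) * w γ|) ''
    {d | (∀ γ, d γ ∈ Set.Icc (-⌈C / w γ⌉) ⌈C / w γ⌉) ∧ (∑ γ, (d γ : ℝ) * w γ) ≠ 0})
  have hT : T.Finite := ((hfin.subset fun d hd => hd.1).image _).insert 1
  obtain ⟨ε, hε, hmin⟩ := Set.exists_min_image T id hT ⟨1, Set.mem_insert _ _⟩
  refine ⟨ε, ?_, fun d hd hne => hmin _ (Set.mem_insert_of_mem _ ⟨d, ⟨fun γ => ?_, hne⟩, rfl⟩)⟩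
  · rcases hε with rfl | ⟨d, hd, rfl⟩
    · exact one_pos
    · exact abs_pos.mpr hd.2
  · have h : |(d γ : ℝ)| ≤ ⌈C / w γ⌉ :=
      ((le_div_iff₀ (hw γ)).mpr (hd γ)).trans (Int.le_ceil _)
    rw [Set.mem_Icc, ← abs_le]
    exact_mod_cast h

/-- If `a` is bounded by `M` and the actions of `a` and `b` differ by at most `1`, then the weighted
coordinates of `a - b` are bounded. -/
theorem abs_sub_mul_le_of_le {P : Type*} [Fintype P] (w : P → ℝ) (hw : ∀ γ, 0 < w γ) (M : ℝ)
    (a b : P → ℕ) (ha : ∀ γ, (a γ : ℝ) ≤ M)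
    (h : |(∑ γ, (a γ : ℝ) * w γ) - ∑ γ, (b γ : ℝ) * w γ| ≤ 1) (γ : P) :
    |(a γ : ℝ) - b γ| * w γ ≤ (∑ γ, M * w γ) + 1 := by
  have hterm (m : P → ℕ) : (m γ : ℝ) * w γ ≤ ∑ γ, (m γ : ℝ) * w γ :=
    Finset.single_le_sum (f := fun γ => (m γ : ℝ) * w γ)
      (fun i _ => mul_nonneg (Nat.cast_nonneg _) (hw i).le) (Finset.mem_univ γ)
  have hsum : ∑ γ, (a γ : ℝ) * w γ ≤ ∑ γ, M * w γ :=
    Finset.sum_le_sum fun i _ => mul_le_mul_of_nonneg_right (ha i) (hw i).le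
  have ha0 : 0 ≤ (a γ : ℝ) * w γ := mul_nonneg (Nat.cast_nonneg _) (hw γ).le
  have hb0 : 0 ≤ (b γ : ℝ) * w γ := mul_nonneg (Nat.cast_nonneg _) (hw γ).le
  have := hterm a
  have := hterm b
  rw [abs_le] at h
  rw [← abs_of_pos (hw γ), ← abs_mul, sub_mul, abs_le]
  constructor <;> linarith

/-- If `a` and `b` are bounded by `M` away from `γ₀` and their actions differ by at most `1`, then
the weighted coordinates of `a - b` are bounded. -/
theorem abs_sub_mul_le_of_le_off {P : Type*} [Fintype P] (w : P → ℝ) (hw : ∀ γ, 0 < w γ) (M : ℝ)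
    (hM : 0 ≤ M) (a b : P → ℕ) (γ₀ : P) (ha : ∀ γ, γ ≠ γ₀ → (a γ : ℝ) ≤ M)
    (hb : ∀ γ, γ ≠ γ₀ → (b γ : ℝ) ≤ M)
    (h : |(∑ γ, (a γ : ℝ) * w γ) - ∑ γ, (b γ : ℝ) * w γ| ≤ 1) (γ : P) :
    |(a γ : ℝ) - b γ| * w γ ≤ (∑ γ, M * w γ) + 1 := by
  classical
  have hMw (i : P) : 0 ≤ M * w i := mul_nonneg hM (hw i).le
  have hoff (i : P) (hi : i ≠ γ₀) : |((a i : ℝ) - b i) * w i| ≤ M * w i := by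
    rw [abs_mul, abs_of_pos (hw i)]
    refine mul_le_mul_of_nonneg_right ?_ (hw i).le
    have := ha i hi
    have := hb i hi
    have : (0 : ℝ) ≤ a i := Nat.cast_nonneg _
    have : (0 : ℝ) ≤ b i := Nat.cast_nonneg _
    rw [abs_le]
    constructor <;> linarith
  rw [← abs_of_pos (hw γ), ← abs_mul]
  by_cases hγ : γ = γ₀
  · subst hγ
    rw [← Finset.sum_sub_distrib] at h
    simp only [← sub_mul] at h
    rw [← Finset.add_sum_erase _ _ (Finset.mem_univ γ)] at h
    have hrest : |∑ i ∈ Finset.univ.erase γ, ((a i : ℝ) - b i) * w i| ≤ ∑ i, M * w i :=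
      (Finset.abs_sum_le_sum_abs _ _).trans <|
        (Finset.sum_le_sum fun i hi => hoff i (Finset.ne_of_mem_erase hi)).trans <|
          Finset.sum_le_sum_of_subset_of_nonneg (Finset.erase_subset _ _) fun i _ _ => hMw i
    rw [abs_le] at h hrest ⊢
    constructor <;> linarith
  · have := Finset.single_le_sum (f := fun i => M * w i) (fun i _ => hMw i) (Finset.mem_univ γ)
    have := hoff γ hγ
    linarith

/-- Let `P` be a finite set of simple Reeb orbits with positive
periods `w`; the action of an orbit set `m : P → ℕ` is `𝒜(m) = Σ_γ m(γ)·w(γ)`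
and its complexity is `max_γ m(γ)`.  For every `M > 1` there is `ε_M > 0` such
that any two orbit sets with distinct actions, at least one of which has
complexity `≤ M`, or which both have exactly one (and the same) simple orbit of
multiplicity `> M`, have actions differing by at least `ε_M`. -/
theorem statement9 {P : Type*} [Fintype P] (w : P → ℝ) (hw : ∀ γ, 0 < w γ)
    (M : ℝ) (hM : 1 < M) :
    ∃ εM : ℝ, 0 < εM ∧ ∀ m₁ m₂ : P → ℕ,
      (∑ γ, (m₁ γ : ℝ) * w γ) ≠ (∑ γ, (m₂ γ : ℝ) * w γ) →
      ((∀ γ, (m₁ γ : ℝ) ≤ M) ∨ (∀ γ, (m₂ γ : ℝ) ≤ M) ∨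
        (∃ γ₀ : P, {γ : P | M < (m₁ γ : ℝ)} = {γ₀} ∧ {γ : P | M < (m₂ γ : ℝ)} = {γ₀})) →
      εM ≤ |(∑ γ, (m₁ γ : ℝ) * w γ) - ∑ γ, (m₂ γ : ℝ) * w γ| := by
  obtain ⟨ε, hε, hmin⟩ := exists_pos_le_abs_sum_of_bounded w hw ((∑ γ, M * w γ) + 1)
  refine ⟨min ε 1, lt_min hε one_pos, fun m₁ m₂ hne hcase => ?_⟩
  by_contra! hlt
  have hle := (hlt.trans_le (min_le_right ε 1)).le
  have hsum : ∑ γ, (((m₁ γ : ℤ) - m₂ γ : ℤ) : ℝ) * w γ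
      = (∑ γ, (m₁ γ : ℝ) * w γ) - ∑ γ, (m₂ γ : ℝ) * w γ := by
    rw [← Finset.sum_sub_distrib]
    exact Finset.sum_congr rfl fun γ _ => by push_cast; ring
  have hbound : ∀ γ, |(m₁ γ : ℝ) - m₂ γ| * w γ ≤ (∑ γ, M * w γ) + 1 := by
    rcases hcase with h | h | ⟨γ₀, h₁, h₂⟩
    · exact abs_sub_mul_le_of_le w hw M m₁ m₂ h hle
    · intro γ
      rw [abs_sub_comm] at hle ⊢
      exact abs_sub_mul_le_of_le w hw M m₂ m₁ h hle γ
    · refine abs_sub_mul_le_of_le_off w hw M (by linarith) m₁ m₂ γ₀ (fun γ hγ => ?_)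
        (fun γ hγ => ?_) hle
      · exact not_lt.mp fun hlt => hγ (h₁.subset hlt)
      · exact not_lt.mp fun hlt => hγ (h₂.subset hlt)
  have := hmin (fun γ => (m₁ γ : ℤ) - m₂ γ) (fun γ => by push_cast; exact hbound γ)
    (by rw [hsum]; exact sub_ne_zero.mpr hne)
  rw [hsum] at this
  exact absurd (hlt.trans_le (min_le_left ε 1)) (not_lt.mpr this)
end
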